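/- Let M = T × [0,1] with T = ℝ/(2πℤ), let δ > 0, and for 0 < ε < 1/4 let ω_ε := δ ε^{-2} 𝟙_{[π−ε,π+ε]}(x₁) 𝟙_{[1/2−ε,1/2+ε]}(x₂) ∈ L^∞(M). Then there exist universal constants 0 < c < C and ε₀ ∈ (0, 1/4), all independent of δ and ε, such that for every ε ∈ (0, ε₀): c · δ² · log(1/ε) ≤ E(ω_ε) ≤ C · δ² · log(1/ε). -/

import Mathlib

open MeasureTheory

noncomputable section

/-- The `k`-th Fourier coefficient in the periodic variable `x₁`:
`ω̂_k(x₂) = (2π)⁻¹ ∫₀^{2π} e^{-i k x₁} ω(x₁, x₂) dx₁`. -/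
def fourierCoef (ω : ℝ × ℝ → ℝ) (k : ℤ) (y : ℝ) : ℂ :=
  (1 / (2 * Real.pi)) * ∫ x₁ in (0:ℝ)..(2 * Real.pi),
    Complex.exp (-(Complex.I * k * x₁)) * (ω (x₁, y) : ℂ)

/-- The Green kernels of the channel with Dirichlet boundary conditions. -/
def green (k : ℤ) (y z : ℝ) : ℝ :=
  if k = 0 then -(min y z * (1 - max y z))
  else -(Real.sinh (k * min y z) * Real.sinh (k * (1 - max y z)) / (k * Real.sinh k))

/-- The (Dirichlet) kinetic energy
`E(ω) = -π Σ_k ∫₀¹∫₀¹ G_k(y,z) ω̂_k(y) conj(ω̂_k(z)) dy dz`. -/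
def energy (ω : ℝ × ℝ → ℝ) : ℝ :=
  -Real.pi * ∑' k : ℤ, (∫ y in (0:ℝ)..1, ∫ z in (0:ℝ)..1,
      ((green k y z : ℂ) * fourierCoef ω k y * (starRingEnd ℂ) (fourierCoef ω k z))).re

/-- The approximate point vortex `ω_ε = δ ε⁻² 𝟙_{[π-ε,π+ε]}(x₁) 𝟙_{[1/2-ε,1/2+ε]}(x₂)`. -/
def boxVortex (δ ε : ℝ) : ℝ × ℝ → ℝ := fun x =>
  δ / ε ^ 2 *
    (Set.Icc (Real.pi - ε) (Real.pi + ε)).indicator (fun _ => (1:ℝ)) x.1 *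
    (Set.Icc (1 / 2 - ε) (1 / 2 + ε)).indicator (fun _ => (1:ℝ)) x.2

lemma bv_ind (c d a b : ℝ) (hca : c ≤ a) (hab : a ≤ b) (hbd : b ≤ d) (f : ℝ → ℂ) :
    ∫ z in c..d, (((Set.Icc a b).indicator (fun _ => (1:ℝ)) z : ℝ) : ℂ) * f z
      = ∫ z in a..b, f z := by
  rw [intervalIntegral.integral_of_le (by linarith), intervalIntegral.integral_of_le hab,
    ← integral_Icc_eq_integral_Ioc, ← integral_Icc_eq_integral_Ioc]
  have : (fun z => (((Set.Icc a b).indicator (fun _ => (1:ℝ)) z : ℝ) : ℂ) * f z)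
      = (Set.Icc a b).indicator f := by
    funext z
    by_cases h : z ∈ Set.Icc a b <;> simp [h]
  rw [this, setIntegral_indicator measurableSet_Icc,
    Set.inter_eq_self_of_subset_right (Set.Icc_subset_Icc hca hbd)]

lemma bv_green_abs (k : ℤ) (y z : ℝ) : green |k| y z = green k y z := by
  rcases abs_choice k with h | h
  · rw [h]
  · rw [h]; simp [green, Real.sinh_neg]

lemma bv_green_cont (k : ℤ) : Continuous (fun p : ℝ × ℝ => green k p.1 p.2) := by
  unfold green
  by_cases h : k = 0
  · simp only [h, if_true]; fun_prop
  · simp only [h, if_false]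
    have := Real.continuous_sinh
    simp only [div_eq_mul_inv]
    fun_prop

/-- the Fourier amplitude -/
def bvJ (ε : ℝ) (k : ℤ) : ℂ :=
  ∫ x in (Real.pi - ε)..(Real.pi + ε), Complex.exp (-(Complex.I * k * x))

/-- double integral of the kernel -/
def bvK (ε : ℝ) (k : ℤ) : ℝ :=
  ∫ y in (1/2 - ε)..(1/2 + ε), ∫ z in (1/2 - ε)..(1/2 + ε), - green k y z

lemma bv_fourier (δ ε : ℝ) (hε : 0 < ε) (hε1 : ε < 1/4) (k : ℤ) (y : ℝ) :
    fourierCoef (boxVortex δ ε) k y =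
      (((δ / ε ^ 2 / (2 * Real.pi) : ℝ) : ℂ) * bvJ ε k) *
      (((Set.Icc (1/2 - ε) (1/2 + ε)).indicator (fun _ => (1:ℝ)) y : ℝ) : ℂ) := by
  have hpi := Real.pi_gt_three
  unfold fourierCoef boxVortex bvJ
  rw [← bv_ind 0 (2 * Real.pi) (Real.pi - ε) (Real.pi + ε) (by linarith) (by linarith)
    (by linarith)]
  rw [mul_assoc _ (intervalIntegral _ _ _ _), ← intervalIntegral.integral_mul_const,
    ← intervalIntegral.integral_const_mul,
    ← intervalIntegral.integral_const_mul]
  congr 1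
  funext x
  push_cast
  field_simp

lemma bv_term (δ ε : ℝ) (hε : 0 < ε) (hε1 : ε < 1/4) (k : ℤ) :
    (∫ y in (0:ℝ)..1, ∫ z in (0:ℝ)..1,
      ((green k y z : ℂ) * fourierCoef (boxVortex δ ε) k y *
        (starRingEnd ℂ) (fourierCoef (boxVortex δ ε) k z))).re
    = - ((δ / ε ^ 2 / (2 * Real.pi)) ^ 2 * ‖bvJ ε k‖ ^ 2 * bvK ε k) := by
  set B : ℂ := ((δ / ε ^ 2 / (2 * Real.pi) : ℝ) : ℂ) * bvJ ε k with hB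
  have hBB : B * (starRingEnd ℂ) B =
      (((δ / ε ^ 2 / (2 * Real.pi)) ^ 2 * ‖bvJ ε k‖ ^ 2 : ℝ) : ℂ) := by
    rw [Complex.mul_conj, Complex.normSq_eq_norm_sq, hB, norm_mul, mul_pow,
      Complex.norm_real, Real.norm_eq_abs, sq_abs]
  have h1 : ∀ y z : ℝ, ((green k y z : ℂ) * fourierCoef (boxVortex δ ε) k y *
        (starRingEnd ℂ) (fourierCoef (boxVortex δ ε) k z)) =
      (B * (starRingEnd ℂ) B) * 
      ((((Set.Icc (1/2 - ε) (1/2 + ε)).indicator (fun _ => (1:ℝ)) y : ℝ) : ℂ) *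
      ((((Set.Icc (1/2 - ε) (1/2 + ε)).indicator (fun _ => (1:ℝ)) z : ℝ) : ℂ) *
       (green k y z : ℂ))) := by
    intro y z
    rw [bv_fourier δ ε hε hε1, bv_fourier δ ε hε hε1, ← hB, map_mul, Complex.conj_ofReal]
    ring
  simp only [h1, intervalIntegral.integral_const_mul]
  simp only [bv_ind 0 1 (1/2 - ε) (1/2 + ε) (by linarith) (by linarith) (by linarith)]
  rw [hBB]
  simp only [intervalIntegral.integral_ofReal]
  rw [← Complex.ofReal_mul, Complex.ofReal_re, bvK]
  simp only [intervalIntegral.integral_neg]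
  ring

lemma bv_J_le (ε : ℝ) (hε : 0 < ε) (k : ℤ) : ‖bvJ ε k‖ ≤ 2 * ε := by
  unfold bvJ
  have := intervalIntegral.norm_integral_le_of_norm_le_const (a := Real.pi - ε) (b := Real.pi + ε)
    (f := fun x : ℝ => Complex.exp (-(Complex.I * k * x))) (C := 1) (by
      intro x _
      rw [Complex.norm_exp]; simp)
  refine this.trans (le_of_eq ?_)
  rw [abs_of_pos (by linarith)]; ring

lemma bv_J_eq (ε : ℝ) (k : ℤ) (hk : k ≠ 0) :
    ‖bvJ ε k‖ = 2 * |Real.sin (k * ε)| / |(k : ℝ)| := by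
  have hkc : (k : ℂ) ≠ 0 := by exact_mod_cast hk
  have hc : -(Complex.I * k) ≠ 0 := by simp [hk]
  have : bvJ ε k = Complex.exp (((-(k * Real.pi) : ℝ) : ℂ) * Complex.I) * (2 * ((Real.sin (k * ε) : ℝ) : ℂ) / k) := by
    unfold bvJ
    have e : ∀ x : ℝ, -(Complex.I * k * x) = (-(Complex.I * k)) * x := by intro x; ring
    simp only [e]
    rw [integral_exp_mul_complex hc]
    push_cast
    rw [Complex.two_sin]
    have e1 : -(Complex.I * k) * ((Real.pi:ℂ) + ε) = -(k * Real.pi) * Complex.I + -(k * ε) * Complex.I := by ring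
    have e2 : -(Complex.I * k) * ((Real.pi:ℂ) - ε) = -(k * Real.pi) * Complex.I + (k * ε) * Complex.I := by ring
    rw [e1, e2, Complex.exp_add, Complex.exp_add]
    rw [neg_mul (k * (ε:ℂ))]
    generalize Complex.exp (-(k * Real.pi) * Complex.I) = P
    generalize Complex.exp (-(k * ε * Complex.I)) = Q
    generalize Complex.exp (k * ε * Complex.I) = R
    rw [div_eq_iff hc]
    have : (k:ℂ) * (k:ℂ)⁻¹ = 1 := mul_inv_cancel₀ hkc
    rw [div_eq_mul_inv]
    linear_combination P * (Q - R) * Complex.I ^ 2 * this + P * (Q - R) * Complex.I_sq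
  rw [this, norm_mul, Complex.norm_exp_ofReal_mul_I, one_mul, norm_div, norm_mul,
    Complex.norm_real, Complex.norm_intCast]
  simp

lemma bv_J_le' (ε : ℝ) (k : ℤ) (hk : k ≠ 0) : ‖bvJ ε k‖ ≤ 2 / |(k : ℝ)| := by
  rw [bv_J_eq ε k hk]
  have := Real.abs_sin_le_one (k * ε)
  gcongr
  linarith

lemma bv_J_ge (ε : ℝ) (hε : 0 < ε) (n : ℕ) (hn : 1 ≤ n) (h : n * ε ≤ 1) :
    4 * ε / Real.pi ≤ ‖bvJ ε n‖ := by
  have hn' : (1:ℝ) ≤ n := by exact_mod_cast hn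
  rw [bv_J_eq ε n (by exact_mod_cast (by omega : n ≠ 0))]
  have hpi := Real.pi_gt_three
  have := Real.mul_le_sin (x := n * ε) (by positivity) (by linarith)
  have h2 := le_abs_self (Real.sin (n * ε))
  push_cast
  rw [abs_of_pos (by linarith : (0:ℝ) < n), le_div_iff₀ (by linarith)]
  calc 4 * ε / Real.pi * n = 2 * (2 / Real.pi * (n * ε)) := by ring
    _ ≤ _ := by linarith

lemma bv_K_bounds (ε : ℝ) (hε : 0 < ε) (k : ℤ) (m M : ℝ)
    (h : ∀ y ∈ Set.Icc (1/2 - ε) (1/2 + ε), ∀ z ∈ Set.Icc (1/2 - ε) (1/2 + ε),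
      m ≤ - green k y z ∧ - green k y z ≤ M) :
    4 * ε ^ 2 * m ≤ bvK ε k ∧ bvK ε k ≤ 4 * ε ^ 2 * M := by
  have hab : (1/2 - ε) ≤ 1/2 + ε := by linarith
  have hc := (bv_green_cont k).neg
  have hcy : ∀ y, Continuous (fun z => - green k y z) := fun y =>
    hc.comp (by fun_prop : Continuous fun z : ℝ => (y, z))
  have hi : Continuous (fun y => ∫ z in (1/2 - ε)..(1/2 + ε), - green k y z) :=
    intervalIntegral.continuous_parametric_intervalIntegral_of_continuous' 
      (f := fun y z => - green k y z) hc _ _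
  have hin : ∀ y ∈ Set.Icc (1/2 - ε) (1/2 + ε), 
      2 * ε * m ≤ (∫ z in (1/2 - ε)..(1/2 + ε), - green k y z) ∧ 
      (∫ z in (1/2 - ε)..(1/2 + ε), - green k y z) ≤ 2 * ε * M := by
    intro y hy
    constructor
    · have := intervalIntegral.integral_mono_on hab (f := fun _ => m) (μ := volume)
        intervalIntegrable_const
        ((hcy y).intervalIntegrable _ _) (fun z hz => (h y hy z hz).1)
      simp only [intervalIntegral.integral_const, smul_eq_mul] at this
      linarith
    · have := intervalIntegral.integral_mono_on hab (g := fun _ => M) (μ := volume)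
        ((hcy y).intervalIntegrable _ _) intervalIntegrable_const (fun z hz => (h y hy z hz).2)
      simp only [intervalIntegral.integral_const, smul_eq_mul] at this
      linarith
  unfold bvK
  constructor
  · have := intervalIntegral.integral_mono_on hab (f := fun _ => 2 * ε * m) (μ := volume)
        intervalIntegrable_const
        (hi.intervalIntegrable _ _) (fun z hz => (hin z hz).1)
    simp only [intervalIntegral.integral_const, smul_eq_mul] at this
    linarith
  · have := intervalIntegral.integral_mono_on hab (g := fun _ => 2 * ε * M) (μ := volume)
        (hi.intervalIntegrable _ _) intervalIntegrable_const (fun z hz => (hin z hz).2)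
    simp only [intervalIntegral.integral_const, smul_eq_mul] at this
    linarith

lemma bv_sinh_le (x : ℝ) : Real.sinh x ≤ Real.exp x / 2 := by
  rw [Real.sinh_eq]; have := Real.exp_pos (-x); linarith

lemma bv_sinh_ge (x : ℝ) (hx : 3/8 ≤ x) : Real.exp x / 5 ≤ Real.sinh x := by
  rw [Real.sinh_eq]
  have h1 := Real.add_one_le_exp (2 * x)
  have h2 : Real.exp (2 * x) * Real.exp (-x) = Real.exp x := by
    rw [← Real.exp_add]; congr 1; ring
  have := Real.exp_pos (-x)
  nlinarith

lemma bv_green_zero (y z : ℝ) (hy : y ∈ Set.Icc (0:ℝ) 1) (hz : z ∈ Set.Icc (0:ℝ) 1) :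
    0 ≤ - green 0 y z ∧ - green 0 y z ≤ 1 := by
  simp only [green, if_true, neg_neg]
  have h1 : 0 ≤ min y z := le_min hy.1 hz.1
  have h2 : max y z ≤ 1 := max_le hy.2 hz.2
  have h3 : min y z ≤ 1 := (min_le_left _ _).trans hy.2
  have h4 : 0 ≤ max y z := hy.1.trans (le_max_left _ _)
  constructor
  · exact mul_nonneg h1 (by linarith)
  · nlinarith

lemma bv_green_nat (n : ℕ) (hn : 1 ≤ n) (y z : ℝ) (hy : y ∈ Set.Icc (0:ℝ) 1)
    (hz : z ∈ Set.Icc (0:ℝ) 1) :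
    0 ≤ - green n y z ∧ - green n y z ≤ 1 / n := by
  have h0 : (n : ℤ) ≠ 0 := by omega
  have hn' : (1:ℝ) ≤ n := by exact_mod_cast hn
  simp only [green, h0, if_false, neg_neg]
  have h1 : 0 ≤ min y z := le_min hy.1 hz.1
  have h2 : max y z ≤ 1 := max_le hy.2 hz.2
  have h3 : min y z ≤ max y z := min_le_max
  push_cast
  set a := min y z
  set b := max y z
  have hs : 0 < Real.sinh n := Real.sinh_pos_iff.2 (by linarith)
  have hs1 : 0 ≤ Real.sinh (n * a) := Real.sinh_nonneg_iff.2 (by positivity)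
  have hs2 : 0 ≤ Real.sinh (n * (1 - b)) :=
    Real.sinh_nonneg_iff.2 (mul_nonneg (by linarith) (by linarith))
  constructor
  · positivity
  · rw [div_le_div_iff₀ (by positivity) (by linarith)]
    have : Real.sinh (n * a) * Real.sinh (n * (1 - b)) ≤ Real.sinh n := by
      calc _ ≤ (Real.exp (n * a) / 2) * (Real.exp (n * (1 - b)) / 2) :=
            mul_le_mul (bv_sinh_le _) (bv_sinh_le _) hs2 (by positivity)
        _ = Real.exp (n * a + n * (1 - b)) / 4 := by rw [Real.exp_add]; ring
        _ ≤ Real.exp n / 4 := by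
            gcongr
            nlinarith
        _ ≤ Real.exp n / 5 + Real.exp n / 20 := by linarith
        _ ≤ Real.sinh n := by
            rw [Real.sinh_eq]
            have h1 := Real.add_one_le_exp (2 * (n:ℝ))
            have h2 : Real.exp (2 * n) * Real.exp (-n) = Real.exp n := by
              rw [← Real.exp_add]; congr 1; ring
            have := Real.exp_pos (-(n:ℝ))
            nlinarith
    nlinarith

lemma bv_green_lower (n : ℕ) (hn : 1 ≤ n) (ε : ℝ) (hε : 0 < ε) (hε1 : ε < 1/8)
    (hne : n * ε ≤ 1) (y z : ℝ)
    (hy : y ∈ Set.Icc (1/2 - ε) (1/2 + ε)) (hz : z ∈ Set.Icc (1/2 - ε) (1/2 + ε)) :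
    2 * Real.exp (-2) / 25 / n ≤ - green n y z := by
  have h0 : (n : ℤ) ≠ 0 := by omega
  have hn' : (1:ℝ) ≤ n := by exact_mod_cast hn
  simp only [green, h0, if_false, neg_neg]
  have h1 : 1/2 - ε ≤ min y z := le_min hy.1 hz.1
  have h2 : max y z ≤ 1/2 + ε := max_le hy.2 hz.2
  push_cast
  set a := min y z
  set b := max y z
  have hs : 0 < Real.sinh n := Real.sinh_pos_iff.2 (by linarith)
  have ha : n * (1/2 - ε) ≤ n * a := by gcongr
  have hb : n * (1/2 - ε) ≤ n * (1 - b) := mul_le_mul_of_nonneg_left (by linarith) (by linarith)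
  have hx : 3/8 ≤ n * (1/2 - ε) := by nlinarith
  have hs1 := bv_sinh_ge (n * a) (by linarith)
  have hs2 := bv_sinh_ge (n * (1 - b)) (by linarith)
  have key : 2 * Real.exp (-2) / 25 * Real.sinh n ≤
      Real.sinh (n * a) * Real.sinh (n * (1 - b)) := by
    calc _ ≤ 2 * Real.exp (-2) / 25 * (Real.exp n / 2) := by gcongr; exact bv_sinh_le _
      _ = Real.exp (-2 + n) / 25 := by rw [Real.exp_add]; ring
      _ ≤ Real.exp (n * a + n * (1 - b)) / 25 := by
          have : -2 + (n:ℝ) ≤ n * a + n * (1 - b) := by nlinarith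
          have := Real.exp_le_exp.2 this
          linarith
      _ = Real.exp (n * a) / 5 * (Real.exp (n * (1 - b)) / 5) := by rw [Real.exp_add]; ring
      _ ≤ _ := mul_le_mul hs1 hs2 (by positivity) (le_trans (by positivity) hs1)
  rw [div_le_div_iff₀ (by linarith) (by positivity)]
  nlinarith

/-- minus the k-th term of the energy -/
def bvT (δ ε : ℝ) (k : ℤ) : ℝ :=
  (δ / ε ^ 2 / (2 * Real.pi)) ^ 2 * ‖bvJ ε k‖ ^ 2 * bvK ε k

/-- majorant -/
def bvV (ε : ℝ) (n : ℕ) : ℝ :=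
  if n = 0 then 1 else if (n:ℝ) ≤ 1 / ε then (n:ℝ)⁻¹ else (1 / ε) * ((n:ℝ) ^ 2)⁻¹

lemma bv_K_abs (ε : ℝ) (k : ℤ) : bvK ε |k| = bvK ε k := by
  simp only [bvK, bv_green_abs]

lemma bv_K_nat (ε : ℝ) (hε : 0 < ε) (hε1 : ε < 1/4) (k : ℤ) (hk : k ≠ 0) :
    0 ≤ bvK ε k ∧ bvK ε k ≤ 4 * ε ^ 2 * (1 / (k.natAbs : ℝ)) := by
  rw [← bv_K_abs, Int.abs_eq_natAbs]
  have := bv_K_bounds ε hε (k.natAbs : ℤ) 0 (1 / (k.natAbs : ℝ)) (fun y hy z hz =>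
    bv_green_nat k.natAbs (by omega) y z ⟨by linarith [hy.1], by linarith [hy.2]⟩
      ⟨by linarith [hz.1], by linarith [hz.2]⟩)
  simpa using this

lemma bv_K_zero (ε : ℝ) (hε : 0 < ε) (hε1 : ε < 1/4) :
    0 ≤ bvK ε 0 ∧ bvK ε 0 ≤ 4 * ε ^ 2 := by
  have := bv_K_bounds ε hε 0 0 1 (fun y hy z hz =>
    bv_green_zero y z ⟨by linarith [hy.1], by linarith [hy.2]⟩
      ⟨by linarith [hz.1], by linarith [hz.2]⟩)
  simpa using this

lemma bv_T_nonneg (δ ε : ℝ) (hε : 0 < ε) (hε1 : ε < 1/4) (k : ℤ) : 0 ≤ bvT δ ε k := by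
  have : 0 ≤ bvK ε k := by
    by_cases hk : k = 0
    · rw [hk]; exact (bv_K_zero ε hε hε1).1
    · exact (bv_K_nat ε hε hε1 k hk).1
  unfold bvT; positivity

lemma bv_T_aux (δ ε j K q : ℝ) (hε : 0 < ε) (hj : 0 ≤ j) (hK0 : 0 ≤ K) 
    (hq : j ^ 2 * K ≤ 16 * ε ^ 4 * q) (hq0 : 0 ≤ q) :
    (δ / ε ^ 2 / (2 * Real.pi)) ^ 2 * j ^ 2 * K ≤ δ ^ 2 * q := by
  have hpi := Real.pi_gt_three
  have : (δ / ε ^ 2 / (2 * Real.pi)) ^ 2 * j ^ 2 * K ≤ 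
      (δ / ε ^ 2 / (2 * Real.pi)) ^ 2 * (16 * ε ^ 4 * q) := by
    rw [mul_assoc]; gcongr
  refine this.trans ?_
  have e : (δ / ε ^ 2 / (2 * Real.pi)) ^ 2 * (16 * ε ^ 4 * q) = δ ^ 2 * q * (4 / Real.pi ^ 2) := by
    field_simp; ring
  rw [e]
  refine mul_le_of_le_one_right (by positivity) ?_
  rw [div_le_one (by positivity)]; nlinarith

lemma bv_T_le (δ ε : ℝ) (hε : 0 < ε) (hε1 : ε < 1/4) (k : ℤ) :
    bvT δ ε k ≤ δ ^ 2 * bvV ε k.natAbs := by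
  unfold bvT bvV
  have hJ := bv_J_le ε hε k
  have hJ0 := norm_nonneg (bvJ ε k)
  by_cases hk : k = 0
  · subst hk
    have hK := bv_K_zero ε hε hε1
    simp only [Int.natAbs_zero, if_true]
    refine bv_T_aux δ ε _ _ 1 hε hJ0 hK.1 ?_ zero_le_one
    calc _ ≤ (2 * ε) ^ 2 * (4 * ε ^ 2) := by gcongr; exact hK.1; exact hK.2
      _ = _ := by ring
  · have hK := bv_K_nat ε hε hε1 k hk
    have hk1 : k.natAbs ≠ 0 := by omega
    have hJ' := bv_J_le' ε k hk
    have habs : |(k:ℝ)| = (k.natAbs : ℝ) := by rw [Nat.cast_natAbs]; simp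
    rw [habs] at hJ'
    have hn : (1:ℝ) ≤ k.natAbs := by exact_mod_cast (by omega : 1 ≤ k.natAbs)
    simp only [hk1, if_false]
    generalize (k.natAbs : ℝ) = n at *
    split_ifs with h
    · refine bv_T_aux δ ε _ _ _ hε hJ0 hK.1 ?_ (by positivity)
      calc _ ≤ (2 * ε) ^ 2 * (4 * ε ^ 2 * (1 / n)) := by gcongr; exact hK.1; exact hK.2
        _ = _ := by field_simp; ring
    · push Not at h
      refine bv_T_aux δ ε _ _ _ hε hJ0 hK.1 ?_ (by positivity)
      have h1 : 1 ≤ ε * n := by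
        rw [div_lt_iff₀ hε] at h; linarith
      calc _ ≤ (2 / n) ^ 2 * (4 * ε ^ 2 * (1 / n)) := by gcongr; exact hK.1; exact hK.2
        _ = 16 * ε ^ 2 / n ^ 3 := by field_simp; ring
        _ ≤ 16 * ε ^ 2 / n ^ 3 * (ε * n) := le_mul_of_one_le_right (by positivity) h1
        _ = _ := by field_simp

lemma bv_T_ge (δ ε : ℝ) (hε : 0 < ε) (hε1 : ε < 1/8) (n : ℕ) (hn : 1 ≤ n) (hne : n * ε ≤ 1) :
    (16 / Real.pi ^ 4 * (2 * Real.exp (-2) / 25)) * δ ^ 2 * (n:ℝ)⁻¹ ≤ bvT δ ε n := by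
  have hpi := Real.pi_pos
  have hJ := bv_J_ge ε hε n hn hne
  have hn' : (1:ℝ) ≤ n := by exact_mod_cast hn
  have hK := (bv_K_bounds ε hε n (2 * Real.exp (-2) / 25 / n) (1 / n) (fun y hy z hz =>
    ⟨bv_green_lower n hn ε hε hε1 hne y z hy hz,
    (bv_green_nat n hn y z ⟨by linarith [hy.1], by linarith [hy.2]⟩
      ⟨by linarith [hz.1], by linarith [hz.2]⟩).2⟩)).1
  unfold bvT
  calc _ = (δ / ε ^ 2 / (2 * Real.pi)) ^ 2 * (4 * ε / Real.pi) ^ 2 *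
        (4 * ε ^ 2 * (2 * Real.exp (-2) / 25 / n)) := by field_simp; ring
    _ ≤ _ := by gcongr

lemma bv_V_nonneg (ε : ℝ) (hε : 0 < ε) (n : ℕ) : 0 ≤ bvV ε n := by
  unfold bvV; split_ifs <;> positivity

lemma bv_V_sum (ε : ℝ) (hε : 0 < ε) (hε1 : ε < 1/8) (M : ℕ) :
    ∑ n ∈ Finset.range M, bvV ε n ≤ 4 + Real.log (1 / ε) := by
  set N := ⌊1 / ε⌋₊ with hN
  have hpos : 0 < 1 / ε := by positivity
  have hsub : Finset.range M ⊆ ({0} ∪ Finset.Icc 1 N) ∪ Finset.Ioo N M := by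
    intro n hn
    simp only [Finset.mem_union, Finset.mem_singleton, Finset.mem_Icc, Finset.mem_Ioo,
      Finset.mem_range] at *
    omega
  have h1 : ∑ n ∈ Finset.Icc 1 N, bvV ε n ≤ 1 + Real.log (1 / ε) := by
    have := harmonic_floor_le_one_add_log (1 / ε) (by rw [le_div_iff₀ hε]; linarith)
    rw [← hN, harmonic_eq_sum_Icc] at this
    push_cast at this
    refine le_trans (le_of_eq ?_) this
    refine Finset.sum_congr rfl fun n hn => ?_
    rw [Finset.mem_Icc] at hn
    have : (n:ℝ) ≤ 1 / ε := (Nat.le_floor_iff hpos.le).1 hn.2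
    unfold bvV
    rw [if_neg (by omega), if_pos this]
  have h2 : ∑ n ∈ Finset.Ioo N M, bvV ε n ≤ 2 := by
    have := sum_Ioo_inv_sq_le (α := ℝ) N M
    have hNlt : 1 / ε < N + 1 := Nat.lt_floor_add_one _
    have e : ∑ n ∈ Finset.Ioo N M, bvV ε n = (1 / ε) * ∑ n ∈ Finset.Ioo N M, ((n:ℝ) ^ 2)⁻¹ := by
      rw [Finset.mul_sum]
      refine Finset.sum_congr rfl fun n hn => ?_
      rw [Finset.mem_Ioo] at hn
      have : ¬ (n:ℝ) ≤ 1 / ε := by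
        intro h
        have := (Nat.le_floor_iff hpos.le).2 h
        omega
      unfold bvV
      rw [if_neg (by omega), if_neg this]
    rw [e]
    calc _ ≤ (1 / ε) * (2 / (N + 1)) := by gcongr
      _ ≤ (N + 1) * (2 / (N + 1)) := by gcongr
      _ = 2 := by field_simp
  have hnn := bv_V_nonneg ε hε
  calc _ ≤ ∑ n ∈ ({0} ∪ Finset.Icc 1 N) ∪ Finset.Ioo N M, bvV ε n :=
        Finset.sum_le_sum_of_subset_of_nonneg hsub (fun _ _ _ => hnn _)
    _ ≤ ∑ n ∈ ({0} ∪ Finset.Icc 1 N), bvV ε n + ∑ n ∈ Finset.Ioo N M, bvV ε n := by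
        rw [← Finset.sum_union_inter]
        linarith [Finset.sum_nonneg (fun n (_ : n ∈ ({0} ∪ Finset.Icc 1 N) ∩ Finset.Ioo N M) => hnn n)]
    _ ≤ (∑ n ∈ {0}, bvV ε n + ∑ n ∈ Finset.Icc 1 N, bvV ε n) + ∑ n ∈ Finset.Ioo N M, bvV ε n := by
        rw [← Finset.sum_union_inter (s₁ := {0})]
        linarith [Finset.sum_nonneg (fun n (_ : n ∈ {0} ∩ Finset.Icc 1 N) => hnn n)]
    _ ≤ _ := by
        have : bvV ε 0 = 1 := by simp [bvV]
        rw [Finset.sum_singleton, this]; linarith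

lemma bv_V_hasSum (ε : ℝ) (hε : 0 < ε) (hε1 : ε < 1/8) :
    ∃ S, HasSum (fun k : ℤ => bvV ε k.natAbs) S ∧ S ≤ 2 * (4 + Real.log (1 / ε)) := by
  have hnn := bv_V_nonneg ε hε
  have hs := summable_of_sum_range_le hnn (bv_V_sum ε hε hε1)
  have hle := Real.tsum_le_of_sum_range_le hnn (bv_V_sum ε hε hε1)
  have hs1 : Summable (fun n => bvV ε (n + 1)) := (summable_nat_add_iff 1).2 hs
  have hadd := hs.sum_add_tsum_nat_add 1
  simp only [Finset.sum_range_one] at hadd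
  have h0 := hnn 0
  refine ⟨_, HasSum.of_nat_of_neg_add_one (f := fun k : ℤ => bvV ε k.natAbs)
    (m := ∑' n, bvV ε n) (m' := ∑' n, bvV ε (n + 1)) ?_ ?_, by linarith⟩
  · simpa using hs.hasSum
  · have : ∀ n : ℕ, (-((n:ℤ) + 1)).natAbs = n + 1 := by intro n; omega
    simp only [this]
    exact hs1.hasSum

lemma bv_energy (δ ε : ℝ) (hε : 0 < ε) (hε1 : ε < 1/4) :
    energy (boxVortex δ ε) = Real.pi * ∑' k : ℤ, bvT δ ε k := by
  unfold energy
  simp only [bv_term δ ε hε hε1, tsum_neg, bvT]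
  ring

/-- the energy of the approximate point vortex is comparable to
`δ² log(1/ε)`, with universal constants independent of `δ` and `ε`. -/
theorem boxVortex_energy_log :
    ∃ c C ε₀ : ℝ, 0 < c ∧ c < C ∧ ε₀ ∈ Set.Ioo (0:ℝ) (1/4) ∧
      ∀ δ : ℝ, 0 < δ → ∀ ε : ℝ, ε ∈ Set.Ioo 0 ε₀ →
        c * δ ^ 2 * Real.log (1 / ε) ≤ energy (boxVortex δ ε) ∧
        energy (boxVortex δ ε) ≤ C * δ ^ 2 * Real.log (1 / ε) := by
  have hpi := Real.pi_pos
  set c₀ : ℝ := 16 / Real.pi ^ 4 * (2 * Real.exp (-2) / 25) with hc₀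
  have hc₀pos : 0 < c₀ := by positivity
  refine ⟨Real.pi * c₀, Real.pi * c₀ + Real.pi * 6, 1/8, by positivity, by linarith, by norm_num, ?_⟩
  intro δ hδ ε hε
  obtain ⟨hε0, hε8⟩ := hε
  have hε4 : ε < 1/4 := by linarith
  rw [bv_energy δ ε hε0 hε4]
  obtain ⟨S, hS, hSle⟩ := bv_V_hasSum ε hε0 hε8
  have hL : 2 ≤ Real.log (1 / ε) := by
    have h1 : Real.log 8 ≤ Real.log (1 / ε) :=
      Real.log_le_log (by norm_num) (by rw [le_div_iff₀ hε0]; linarith)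
    have h2 : Real.log 8 = 3 * Real.log 2 := by
      rw [show (8:ℝ) = 2 ^ 3 by norm_num, Real.log_pow]; norm_num
    linarith [Real.log_two_gt_d9]
  have hS' := hS.mul_left (δ ^ 2)
  have hT := bv_T_le δ ε hε0 hε4
  have hTn := bv_T_nonneg δ ε hε0 hε4
  have hsum : Summable (bvT δ ε) := Summable.of_nonneg_of_le hTn hT hS'.summable
  constructor
  · have h1 := hsum.sum_le_tsum ((Finset.Icc 1 ⌊1 / ε⌋₊).map Nat.castEmbedding)
      (fun k _ => hTn k)
    rw [Finset.sum_map] at h1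
    have h2 : c₀ * δ ^ 2 * Real.log (1 / ε) ≤ ∑ n ∈ Finset.Icc 1 ⌊1 / ε⌋₊, bvT δ ε (n : ℤ) := by
      have h3 := log_le_harmonic_floor (1 / ε) (by positivity)
      rw [harmonic_eq_sum_Icc] at h3
      push_cast at h3
      calc _ ≤ c₀ * δ ^ 2 * ∑ n ∈ Finset.Icc 1 ⌊1 / ε⌋₊, (n:ℝ)⁻¹ := by gcongr
        _ ≤ _ := by
          rw [Finset.mul_sum]
          refine Finset.sum_le_sum fun n hn => ?_
          rw [Finset.mem_Icc] at hn
          have : (n:ℝ) ≤ 1 / ε := (Nat.le_floor_iff (by positivity)).1 hn.2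
          exact bv_T_ge δ ε hε0 hε8 n hn.1 (by rwa [le_div_iff₀ hε0] at this)
    calc _ = Real.pi * (c₀ * δ ^ 2 * Real.log (1 / ε)) := by ring
      _ ≤ _ := by
        gcongr
        exact h2.trans h1
  · have h1 : ∑' k, bvT δ ε k ≤ δ ^ 2 * S := by
      rw [← hS'.tsum_eq]
      exact hsum.tsum_le_tsum hT hS'.summable
    have h2 : S ≤ 6 * Real.log (1 / ε) := by linarith
    calc _ ≤ Real.pi * (δ ^ 2 * (6 * Real.log (1 / ε))) := by
          gcongr
          exact h1.trans (by gcongr)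
      _ ≤ Real.pi * (δ ^ 2 * (6 * Real.log (1 / ε))) + Real.pi * c₀ * δ ^ 2 * Real.log (1 / ε) :=
          le_add_of_nonneg_right (by positivity)
      _ = _ := by ring

end
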